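/- Fix an integer k ≥ 3, an integer d ≥ 1, and reals τ ∈ (2,3), γ > 1, w₀ > 0 with k > 2/(3−τ). For n ∈ ℕ define E_n := C(n,k) · ∫_{[w₀,∞)^k} ∫_{(𝕋^d)^k} ∏_{i=1}^k ℓ w_i^{−τ} · ∏_{1≤i<j≤k} min{1, (w_i w_j/(μ n ‖x_i − x_j‖^d))^γ} dx₁⋯dx_k dw₁⋯dw_k (which equals the expected number of k-cliques in the geometric inhomogeneous random graph on n vertices with i.i.d. Pareto(τ) weights, i.i.d. uniform torus positions, and conditionally independent edges with probabilities min{1, (w_u w_v/(μ n ‖x_u − x_v‖^d))^γ}). Then lim_{n→∞} E_n / n^{(3−τ)k/2} = ℓ^k · J^{NG} / (μ^{(τ−1)k/2} · k!), and this limit is finite. -/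

import Mathlib

open MeasureTheory Real Finset
open scoped ENNReal Topology

/-- The mean `μ = (τ-1)/(τ-2)·w₀` of the Pareto distribution with exponent `τ`. -/
noncomputable def paretoMean (τ w₀ : ℝ) : ℝ := (τ - 1) / (τ - 2) * w₀

/-- The normalizing constant `ℓ = (τ-1)·w₀^{τ-1}` of the Pareto density `ℓ w^{-τ}`. -/
noncomputable def paretoScale (τ w₀ : ℝ) : ℝ := (τ - 1) * w₀ ^ (τ - 1)

/-- The connection probability `min{1, (t/r)^γ}`, interpreted as `1` when `r = 0`. -/
noncomputable def edgeProb (γ t r : ℝ) : ℝ := if r = 0 then 1 else min 1 ((t / r) ^ γ)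

/-- The integral `J^{NG}` (as an extended nonnegative real). -/
noncomputable def JNG (k d : ℕ) (τ γ : ℝ) : ℝ≥0∞ :=
  ∫⁻ y : Fin k → ℝ in {y | ∀ i, 0 < y i},
    ∫⁻ x : Fin k → Fin d → AddCircle (1 : ℝ),
      ENNReal.ofReal ((∏ i, y i ^ (-τ)) *
        ∏ i : Fin k, ∏ j ∈ Finset.Ioi i,
          edgeProb γ (y i * y j) (dist (x i) (x j) ^ d))

/-- The expected number of `k`-cliques in the GIRG on `n` vertices: `C(n,k)` times the
probability that `k` i.i.d. Pareto weights and uniform torus positions, connected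
independently with probabilities `min{1, (w_u w_v/(μ n ‖x_u - x_v‖^d))^γ}`, form a clique. -/
noncomputable def expectedCliques (k d : ℕ) (τ γ w₀ : ℝ) (n : ℕ) : ℝ :=
  (n.choose k : ℝ) *
    (∫⁻ w : Fin k → ℝ in {w | ∀ i, w₀ ≤ w i},
      ∫⁻ x : Fin k → Fin d → AddCircle (1 : ℝ),
        ENNReal.ofReal ((∏ i, paretoScale τ w₀ * w i ^ (-τ)) *
          ∏ i : Fin k, ∏ j ∈ Finset.Ioi i,
            edgeProb γ (w i * w j)
              (paretoMean τ w₀ * n * dist (x i) (x j) ^ d))).toReal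

lemma ep_nonneg {γ t r : ℝ} (ht : 0 ≤ t) (hr : 0 ≤ r) : 0 ≤ edgeProb γ t r := by
  unfold edgeProb
  split_ifs
  · exact zero_le_one
  · exact le_min zero_le_one (rpow_nonneg (div_nonneg ht hr) _)

lemma ep_le_one {γ t r : ℝ} : edgeProb γ t r ≤ 1 := by
  unfold edgeProb
  split_ifs
  · exact le_rfl
  · exact min_le_left _ _

lemma ep_scale {γ t r c : ℝ} (hc : c ≠ 0) : edgeProb γ (c * t) (c * r) = edgeProb γ t r := by
  unfold edgeProb
  simp [hc, mul_div_mul_left]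

lemma ep_meas (γ t : ℝ) : Measurable (fun r => edgeProb γ t r) := by
  unfold edgeProb
  refine Measurable.ite (measurableSet_singleton _) measurable_const ?_
  fun_prop

lemma lint_prod_le {E : Type*} [MeasureSpace E] [SigmaFinite (volume : Measure E)] (n : ℕ)
    (f : Fin n → E → ℝ≥0∞) (hf : ∀ i, Measurable (f i)) :
    ∫⁻ x : Fin n → E, ∏ i, f i (x i) ≤ ∏ i, ∫⁻ x, f i x := by
  induction n with
  | zero => simp [volume_pi]
  | succ n ih =>
    rw [← ((volume_preserving_piFinSuccAbove (fun _ => E) 0).symm).lintegral_comp_emb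
      (MeasurableEquiv.measurableEmbedding _)]
    simp_rw [MeasurableEquiv.piFinSuccAbove_symm_apply, Fin.insertNthEquiv,
      Fin.prod_univ_succ, Equiv.coe_fn_mk, Fin.insertNth_zero, Fin.cons_succ, Fin.cons_zero]
    refine (lintegral_prod_le _).trans ?_
    have : ∀ a : E, ∫⁻ z : Fin n → E, f 0 a * ∏ j, f j.succ (z j) =
        f 0 a * ∫⁻ z : Fin n → E, ∏ j, f j.succ (z j) := fun a =>
      lintegral_const_mul _ (Finset.measurable_prod _ fun i _ =>
        (hf i.succ).comp (measurable_pi_apply i))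
    refine (lintegral_mono fun a => (this a).le).trans ?_
    rw [lintegral_mul_const _ (hf 0)]
    gcongr
    exact ih _ fun i => hf _

lemma split_le {E : Type*} [MeasureSpace E] [SigmaFinite (volume : Measure E)] (K : ℕ)
    (m : Fin (K+1)) (F : E → ℝ≥0∞) (G : Fin K → E → E → ℝ≥0∞) (hG : ∀ i a, Measurable (G i a)) :
    ∫⁻ x : Fin (K+1) → E, F (x m) * ∏ j, G j (x m) (x (m.succAbove j))
      ≤ ∫⁻ a, F a * ∏ j, ∫⁻ b, G j a b := by
  rw [← ((volume_preserving_piFinSuccAbove (fun _ => E) m).symm).lintegral_comp_emb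
      (MeasurableEquiv.measurableEmbedding _)]
  simp_rw [MeasurableEquiv.piFinSuccAbove_symm_apply, Fin.insertNthEquiv,
      Equiv.coe_fn_mk, Fin.insertNth_apply_same, Fin.insertNth_apply_succAbove]
  refine (lintegral_prod_le _).trans ?_
  refine lintegral_mono fun a => ?_
  have : ∫⁻ z : Fin K → E, F a * ∏ j, G j a (z j) =
        F a * ∫⁻ z : Fin K → E, ∏ j, G j a (z j) :=
      lintegral_const_mul _ (Finset.measurable_prod _ fun i _ =>
        (hG i a).comp (measurable_pi_apply i))
  simp only [this]
  gcongr
  exact lint_prod_le _ _ fun i => hG i a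

lemma vol_univ (d : ℕ) : (volume : Measure (Fin d → AddCircle (1:ℝ))) Set.univ = 1 := by
  simp [volume_pi, Measure.pi_univ, AddCircle.measure_univ]

lemma ball_le (d : ℕ) (a : Fin d → AddCircle (1:ℝ)) (ρ : ℝ) (hρ : 0 ≤ ρ) :
    volume (Metric.closedBall a ρ) ≤ ENNReal.ofReal ((2 * ρ) ^ d) := by
  rw [MeasureTheory.volume_pi_closedBall _ hρ]
  simp_rw [AddCircle.volume_closedBall]
  rw [ENNReal.ofReal_pow (by positivity)]
  refine (Finset.prod_le_pow_card _ _ (ENNReal.ofReal (2*ρ)) fun i _ =>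
    ENNReal.ofReal_le_ofReal (min_le_right _ _)).trans (by simp)

lemma ep_int (d : ℕ) (hd : 1 ≤ d) (γ t : ℝ) (hγ : 1 < γ) (ht : 0 < t)
    (a : Fin d → AddCircle (1:ℝ)) :
    ∫⁻ b, ENNReal.ofReal (edgeProb γ t (dist a b ^ d)) ≤
      ENNReal.ofReal (2 ^ d * (1 / (1 - 1/γ)) * t) := by
  have hγ0 : 0 < γ := by linarith
  have hγ1 : 1 / γ < 1 := by rw [div_lt_one hγ0]; exact hγ
  have hm : Measurable (fun b => edgeProb γ t (dist a b ^ d)) :=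
    (ep_meas γ t).comp (by fun_prop)
  rw [lintegral_eq_lintegral_meas_le _
    (Filter.Eventually.of_forall fun b => ep_nonneg ht.le (by positivity)) hm.aemeasurable]
  have key : ∀ s ∈ Set.Ioi (0:ℝ), volume {b | s ≤ edgeProb γ t (dist a b ^ d)} ≤
      (Set.Ioc (0:ℝ) 1).indicator (fun s => ENNReal.ofReal (2^d * t * s ^ (-(1/γ)))) s := by
    intro s hs
    have hs : 0 < s := hs
    by_cases h1 : s ≤ 1
    · rw [Set.indicator_of_mem (show s ∈ Set.Ioc (0:ℝ) 1 from ⟨hs, h1⟩)]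
      set ρ := (t * s ^ (-(1/γ))) ^ ((1:ℝ)/d) with hρ
      have hb : 0 < t * s ^ (-(1/γ)) := by positivity
      have hρd : ρ ^ d = t * s ^ (-(1/γ)) := by
        rw [hρ, one_div (d:ℝ), Real.rpow_inv_natCast_pow hb.le (by omega)]
      have hρ0 : 0 ≤ ρ := by positivity
      have : {b | s ≤ edgeProb γ t (dist a b ^ d)} ⊆ Metric.closedBall a ρ := by
        intro b hb'
        simp only [Set.mem_ofPred_eq, edgeProb] at hb'
        rw [Metric.mem_closedBall, dist_comm]
        split_ifs at hb' with h0
        · have := pow_eq_zero_iff (by omega : d ≠ 0) |>.1 h0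
          rw [this]; exact hρ0
        · have hr : 0 < dist a b ^ d := lt_of_le_of_ne (by positivity) (Ne.symm h0)
          have h2 := hb'.trans (min_le_right _ _)
          refine le_of_pow_le_pow_left₀ (by omega : d ≠ 0) hρ0 ?_
          rw [hρd]
          have h3 : s ^ (1/γ) ≤ t / dist a b ^ d := by
            have := Real.rpow_le_rpow hs.le h2 (by positivity : 0 ≤ 1/γ)
            rwa [← Real.rpow_mul (by positivity), mul_one_div_cancel hγ0.ne', Real.rpow_one] at this
          rw [Real.rpow_neg hs.le, ← div_eq_mul_inv]
          have : 0 < s ^ (1/γ) := by positivity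
          rw [le_div_iff₀ hr] at h3
          rw [le_div_iff₀ this]; linarith
      refine (measure_mono this).trans ((ball_le d a ρ hρ0).trans ?_)
      rw [mul_pow, hρd, mul_assoc]
    · rw [show {b | s ≤ edgeProb γ t (dist a b ^ d)} = ∅ from ?_]
      · simp
      · ext b
        simp only [Set.mem_ofPred_eq, Set.mem_empty_iff_false, iff_false, not_le]
        exact ep_le_one.trans_lt (not_le.1 h1)
  refine (setLIntegral_mono' measurableSet_Ioi key).trans ?_
  refine (setLIntegral_le_lintegral _ _).trans ?_
  rw [lintegral_indicator measurableSet_Ioc]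
  have hi : IntervalIntegrable (fun s : ℝ => s ^ (-(1/γ))) volume 0 1 :=
    intervalIntegral.intervalIntegrable_rpow' (by linarith)
  rw [intervalIntegrable_iff_integrableOn_Ioc_of_le zero_le_one] at hi
  rw [← ofReal_integral_eq_lintegral_ofReal (hi.const_mul _)
    (by
      filter_upwards [ae_restrict_mem measurableSet_Ioc] with s hs
      have := hs.1
      show 0 ≤ _
      positivity)]
  apply ENNReal.ofReal_le_ofReal
  rw [integral_const_mul, ← intervalIntegral.integral_of_le zero_le_one, integral_rpow
    (Or.inl (by linarith)), Real.one_rpow, Real.zero_rpow (by linarith)]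
  apply le_of_eq
  ring

lemma h_bound {τ C a : ℝ} (hτ : 2 < τ) (hC : 0 < C) (ha : 0 < a) :
    ∫⁻ b, (Set.Ici a).indicator (fun b => ENNReal.ofReal (b ^ (-τ)) *
      min 1 (ENNReal.ofReal (C * (a * b)))) b ≤ ENNReal.ofReal (C / (τ - 2) * a ^ (3 - τ)) ∧
    ∫⁻ b, (Set.Ici a).indicator (fun b => ENNReal.ofReal (b ^ (-τ)) *
      min 1 (ENNReal.ofReal (C * (a * b)))) b ≤ ENNReal.ofReal (1 / (τ - 1) * a ^ (1 - τ)) := by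
  rw [lintegral_indicator measurableSet_Ici, setLIntegral_congr (Ioi_ae_eq_Ici).symm]
  constructor
  · calc _ ≤ ∫⁻ b in Set.Ioi a, ENNReal.ofReal (C * a * b ^ (1 - τ)) := by
          refine setLIntegral_mono' measurableSet_Ioi fun b hb => ?_
          have hb0 : 0 < b := ha.trans hb
          refine (mul_le_mul_right (min_le_right _ _) _).trans ?_
          rw [← ENNReal.ofReal_mul (by positivity)]
          apply ENNReal.ofReal_le_ofReal
          rw [show 1 - τ = -τ + 1 by ring, Real.rpow_add hb0, Real.rpow_one]
          apply le_of_eq; ring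
      _ ≤ _ := by
          rw [← ofReal_integral_eq_lintegral_ofReal
            ((integrableOn_Ioi_rpow_of_lt (by linarith) ha).const_mul _)
            (by
              filter_upwards [ae_restrict_mem measurableSet_Ioi] with s hs
              have : 0 < s := ha.trans hs
              show 0 ≤ _
              positivity)]
          apply ENNReal.ofReal_le_ofReal
          have e : a ^ (3 - τ) = a ^ (1 - τ + 1) * a := by
            rw [← Real.rpow_add_one ha.ne']; congr 1; ring
          rw [integral_const_mul, integral_Ioi_rpow_of_lt (by linarith) ha, e]
          generalize a ^ (1 - τ + 1) = q
          have : τ - 2 ≠ 0 := by linarith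
          have h' : 1 - τ + 1 ≠ 0 := by intro h; apply this; linarith
          apply le_of_eq; field_simp; ring
  · calc _ ≤ ∫⁻ b in Set.Ioi a, ENNReal.ofReal (b ^ (- τ)) := by
          refine setLIntegral_mono' measurableSet_Ioi fun b hb => ?_
          exact (mul_le_mul_right (min_le_left _ _) _).trans (by simp)
      _ ≤ _ := by
          rw [← ofReal_integral_eq_lintegral_ofReal
            ((integrableOn_Ioi_rpow_of_lt (by linarith) ha))
            (by
              filter_upwards [ae_restrict_mem measurableSet_Ioi] with s hs
              have : 0 < s := ha.trans hs
              show 0 ≤ _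
              positivity)]
          apply ENNReal.ofReal_le_ofReal
          rw [integral_Ioi_rpow_of_lt (by linarith) ha, show 1 - τ = -τ + 1 by ring]
          have : τ - 1 ≠ 0 := by linarith
          have h' : -τ + 1 ≠ 0 := by intro h; apply this; linarith
          apply le_of_eq; field_simp; ring

lemma outer_fin {τ C : ℝ} (K : ℕ) (hτ : 2 < τ) (hC : 0 < C)
    (hK : 2 < (3 - τ) * (K + 1)) :
    ∫⁻ a in Set.Ioi (0:ℝ), ENNReal.ofReal (a ^ (-τ)) *
      (∫⁻ b, (Set.Ici a).indicator (fun b => ENNReal.ofReal (b ^ (-τ)) *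
      min 1 (ENNReal.ofReal (C * (a * b)))) b) ^ K ≠ ⊤ := by
  have gen : ∀ (S : Set ℝ) (c e : ℝ), 0 ≤ c → MeasurableSet S → S ⊆ Set.Ioi 0 →
      (∀ a ∈ S, (∫⁻ b, (Set.Ici a).indicator (fun b => ENNReal.ofReal (b ^ (-τ)) *
      min 1 (ENNReal.ofReal (C * (a * b)))) b) ≤ ENNReal.ofReal (c * a ^ e)) →
      IntegrableOn (fun a : ℝ => a ^ (-τ + e * K)) S →
      ∫⁻ a in S, ENNReal.ofReal (a ^ (-τ)) *
      (∫⁻ b, (Set.Ici a).indicator (fun b => ENNReal.ofReal (b ^ (-τ)) *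
      min 1 (ENNReal.ofReal (C * (a * b)))) b) ^ K < ⊤ := by
    intro S c e hc hS hS0 hb hi
    refine lt_of_le_of_lt ?_ (hi.const_mul (c ^ K)).lintegral_lt_top
    refine setLIntegral_mono' hS fun a ha => ?_
    have ha0 : 0 < a := hS0 ha
    have hh := pow_le_pow_left₀ zero_le (hb a ha) K
    refine (mul_le_mul_right hh _).trans ?_
    rw [← ENNReal.ofReal_pow (by positivity), ← ENNReal.ofReal_mul (by positivity)]
    apply ENNReal.ofReal_le_ofReal
    rw [mul_pow, ← Real.rpow_mul_natCast ha0.le, Real.rpow_add ha0]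
    apply le_of_eq; ring
  rw [← Set.Ioc_union_Ioi_eq_Ioi (zero_le_one : (0:ℝ) ≤ 1)]
  refine ne_top_of_le_ne_top ?_ (lintegral_union_le _ _ _)
  refine (ENNReal.add_lt_top.2 ⟨?_, ?_⟩).ne
  · refine gen _ (C / (τ - 2)) (3 - τ) (div_nonneg hC.le (by linarith)) measurableSet_Ioc
      (fun a h => h.1) (fun a h => (h_bound hτ hC h.1).1) ?_
    rw [← intervalIntegrable_iff_integrableOn_Ioc_of_le zero_le_one]
    exact intervalIntegral.intervalIntegrable_rpow' (by linarith)
  · refine gen _ (1 / (τ - 1)) (1 - τ) (one_div_nonneg.2 (by linarith)) measurableSet_Ioi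
      (fun a h => (zero_lt_one.trans h : (0:ℝ) < a)) (fun a h => (h_bound hτ hC (zero_lt_one.trans h)).2) ?_
    refine integrableOn_Ioi_rpow_of_lt ?_ zero_lt_one
    have : 0 ≤ (τ - 1) * K := mul_nonneg (by linarith) (Nat.cast_nonneg _)
    linarith

lemma star_le (K : ℕ) (m : Fin (K+1)) (p : Fin (K+1) → Fin (K+1) → ℝ) (h0 : ∀ i j, 0 ≤ p i j)
    (h1 : ∀ i j, p i j ≤ 1) (hs : ∀ i j, p i j = p j i) :
    ∏ i, ∏ j ∈ Finset.Ioi i, p i j ≤ ∏ j, p m (m.succAbove j) := by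
  have e : ∏ j, p m (m.succAbove j) = ∏ i, if i = m then 1 else p m i := by
    rw [Fin.prod_univ_succAbove _ m]
    simp [Fin.succAbove_ne]
  rw [e]
  have hq : ∏ i, (if i = m then 1 else p m i) =
      ∏ i, ((if i < m then p i m else 1) * if i = m then ∏ j ∈ Finset.Ioi m, p m j else 1) := by
    rw [Finset.prod_mul_distrib, Finset.prod_ite_eq' Finset.univ m]
    simp only [Finset.mem_univ, if_true]
    have : ∏ j ∈ Finset.Ioi m, p m j = ∏ j, if m < j then p m j else 1 := by
      rw [← Finset.prod_filter]
      congr 1; ext; simp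
    rw [this, ← Finset.prod_mul_distrib]
    refine Finset.prod_congr rfl fun i _ => ?_
    rcases lt_trichotomy i m with h | h | h
    · simp [h, h.ne, h.not_gt, hs]
    · simp [h]
    · simp [h, h.ne', h.not_gt]
  rw [hq]
  refine Finset.prod_le_prod (fun i _ => Finset.prod_nonneg fun j _ => h0 _ _) fun i _ => ?_
  rcases lt_trichotomy i m with h | h | h
  · simp only [h, h.ne, if_true, if_false, mul_one]
    have := Finset.prod_le_prod_of_subset_of_le_one (f := p i)
      (Finset.singleton_subset_iff.2 (Finset.mem_Ioi.2 h)) (fun j _ => h0 _ _) (fun j _ _ => h1 _ _)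
    simpa using this
  · simp [h]
  · simp only [h.not_gt, h.ne', if_false, mul_one]
    exact Finset.prod_le_one (fun j _ => h0 _ _) (fun j _ => h1 _ _)

lemma JNG_fin (K d : ℕ) (hd : 1 ≤ d) (τ γ : ℝ) (hτ : 2 < τ) (hγ : 1 < γ)
    (hK : 2 < (3 - τ) * (K + 1)) : JNG (K+1) d τ γ ≠ ⊤ := by
  set C : ℝ := 2 ^ d * (1 / (1 - 1/γ)) with hCdef
  have hγ1 : 1 / γ < 1 := by rw [div_lt_one (by linarith)]; exact hγ
  have hC : 0 < C := by
    have : 0 < 1 - 1 / γ := by linarith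
    positivity
  unfold JNG
  have hsub : {y : Fin (K+1) → ℝ | ∀ i, 0 < y i} ⊆
      ⋃ m : Fin (K+1), {y | 0 < y m ∧ ∀ j, y m ≤ y j} := by
    intro y hy
    obtain ⟨m, hm⟩ := Finite.exists_min y
    exact Set.mem_iUnion.2 ⟨m, hy m, hm⟩
  refine ne_top_of_le_ne_top ?_ (lintegral_mono_set hsub)
  refine ne_top_of_le_ne_top ?_ (lintegral_iUnion_le _ _)
  rw [tsum_fintype]
  refine (ENNReal.sum_lt_top.2 fun m _ => ?_).ne
  set H : ℝ → ℝ → ℝ≥0∞ := fun a => (Set.Ici a).indicator (fun b => ENNReal.ofReal (b ^ (-τ)) *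
      min 1 (ENNReal.ofReal (C * (a * b)))) with hH
  have hmeas : MeasurableSet {y : Fin (K+1) → ℝ | 0 < y m ∧ ∀ j, y m ≤ y j} := by
    have : {y : Fin (K+1) → ℝ | 0 < y m ∧ ∀ j, y m ≤ y j} =
        {y | 0 < y m} ∩ ⋂ j, {y | y m ≤ y j} := by
      ext; simp
    rw [this]
    refine MeasurableSet.inter (measurableSet_lt measurable_const (measurable_pi_apply m)) ?_
    exact MeasurableSet.iInter fun j =>
      measurableSet_le (measurable_pi_apply m) (measurable_pi_apply j)
  have hpt : ∀ y ∈ {y : Fin (K+1) → ℝ | 0 < y m ∧ ∀ j, y m ≤ y j},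
      ∫⁻ x : Fin (K+1) → Fin d → AddCircle (1 : ℝ),
      ENNReal.ofReal ((∏ i, y i ^ (-τ)) *
        ∏ i : Fin (K+1), ∏ j ∈ Finset.Ioi i,
          edgeProb γ (y i * y j) (dist (x i) (x j) ^ d)) ≤
      (Set.Ioi (0:ℝ)).indicator (fun a => ENNReal.ofReal (a ^ (-τ))) (y m) *
        ∏ j : Fin K, H (y m) (y (m.succAbove j)) := by
    rintro y ⟨hym, hy⟩
    have hy0 : ∀ i, 0 < y i := fun i => hym.trans_le (hy i)
    rw [Set.indicator_of_mem (show y m ∈ Set.Ioi (0:ℝ) from hym)]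
    calc _ ≤ ∫⁻ x : Fin (K+1) → Fin d → AddCircle (1 : ℝ),
          ENNReal.ofReal (∏ i, y i ^ (-τ)) * ∏ j : Fin K,
            ENNReal.ofReal (edgeProb γ (y m * y (m.succAbove j))
              (dist (x m) (x (m.succAbove j)) ^ d)) := by
          refine lintegral_mono fun x => ?_
          have hp : 0 ≤ ∏ i, y i ^ (-τ) :=
            Finset.prod_nonneg fun i _ => rpow_nonneg (hy0 i).le _
          have hn : ∀ i j, 0 ≤ edgeProb γ (y i * y j) (dist (x i) (x j) ^ d) := fun i j =>
            ep_nonneg (mul_nonneg (hy0 i).le (hy0 j).le) (by positivity)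
          rw [← ENNReal.ofReal_prod_of_nonneg fun j _ => hn _ _, ← ENNReal.ofReal_mul hp]
          apply ENNReal.ofReal_le_ofReal
          refine mul_le_mul_of_nonneg_left ?_ hp
          exact star_le K m (fun i j => edgeProb γ (y i * y j) (dist (x i) (x j) ^ d)) hn
            (fun i j => ep_le_one) (fun i j => by simp only [mul_comm (y i), dist_comm (x i)])
      _ ≤ ∫⁻ a : Fin d → AddCircle (1 : ℝ), ENNReal.ofReal (∏ i, y i ^ (-τ)) * ∏ j : Fin K,
            ∫⁻ b : Fin d → AddCircle (1 : ℝ),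
              ENNReal.ofReal (edgeProb γ (y m * y (m.succAbove j)) (dist a b ^ d)) := by
          exact split_le K m (fun _ => ENNReal.ofReal (∏ i, y i ^ (-τ)))
            (fun j a b => ENNReal.ofReal (edgeProb γ (y m * y (m.succAbove j)) (dist a b ^ d)))
            (fun j a => ENNReal.measurable_ofReal.comp ((ep_meas γ _).comp (by fun_prop)))
      _ ≤ ∫⁻ a : Fin d → AddCircle (1 : ℝ), ENNReal.ofReal (∏ i, y i ^ (-τ)) * ∏ j : Fin K,
            min 1 (ENNReal.ofReal (C * (y m * y (m.succAbove j)))) := by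
          refine lintegral_mono fun a => mul_le_mul_right (Finset.prod_le_prod' fun j _ => ?_) _
          refine le_min ?_ (ep_int d hd γ _ hγ (mul_pos hym (hy0 _)) a)
          calc _ ≤ ∫⁻ b : Fin d → AddCircle (1 : ℝ), 1 := lintegral_mono fun b => by
                rw [← ENNReal.ofReal_one]; exact ENNReal.ofReal_le_ofReal ep_le_one
            _ = 1 := by simp [vol_univ]
      _ = _ := by
          rw [lintegral_const, vol_univ, mul_one, Fin.prod_univ_succAbove _ m,
            ENNReal.ofReal_mul (rpow_nonneg hym.le _), mul_assoc,
            ENNReal.ofReal_prod_of_nonneg fun j _ => rpow_nonneg (hy0 _).le _,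
            ← Finset.prod_mul_distrib]
          congr 1
          refine Finset.prod_congr rfl fun j _ => ?_
          simp only [hH]
          rw [Set.indicator_of_mem (show y (m.succAbove j) ∈ Set.Ici (y m) from hy _)]
  refine (setLIntegral_mono' hmeas hpt).trans_lt ?_
  refine (setLIntegral_le_lintegral _ _).trans_lt ?_
  refine (split_le K m _ (fun _ => H) fun j a => ?_).trans_lt ?_
  · refine Measurable.indicator ?_ measurableSet_Ici
    fun_prop
  · have := outer_fin K hτ hC hK
    rw [← lintegral_indicator measurableSet_Ioi] at this
    refine lt_of_le_of_lt (lintegral_mono fun a => ?_) (lt_top_iff_ne_top.2 this)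
    by_cases ha : a ∈ Set.Ioi (0:ℝ)
    · simp [Set.indicator_of_mem ha, hH]
    · simp [Set.indicator_of_notMem ha]

lemma lint_smul (k : ℕ) (s : ℝ) (hs : 0 < s) (f : (Fin k → ℝ) → ℝ≥0∞) :
    ∫⁻ w, f w = ENNReal.ofReal (s ^ k) * ∫⁻ y, f (s • y) := by
  have hm : MeasurableEmbedding (fun y : Fin k → ℝ => s • y) :=
    (Homeomorph.smulOfNeZero s hs.ne').measurableEmbedding
  have h := Measure.map_addHaar_smul (volume : Measure (Fin k → ℝ)) hs.ne'
  have h2 := hm.lintegral_map (μ := volume) f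
  rw [← h2, show (fun y : Fin k → ℝ => s • y) = (s • ·) from rfl, h, lintegral_smul_measure]
  have hp : 0 < s ^ k := by positivity
  rw [smul_eq_mul, ← mul_assoc, Module.finrank_fin_fun, abs_of_pos (inv_pos.2 hp),
    ← ENNReal.ofReal_mul hp.le, mul_inv_cancel₀ hp.ne', ENNReal.ofReal_one, one_mul]

/-- The inner (spatial) integral of `JNG`. -/
noncomputable def innerJ (k d : ℕ) (τ γ : ℝ) (y : Fin k → ℝ) : ℝ≥0∞ :=
    ∫⁻ x : Fin k → Fin d → AddCircle (1 : ℝ),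
      ENNReal.ofReal ((∏ i, y i ^ (-τ)) *
        ∏ i : Fin k, ∏ j ∈ Finset.Ioi i,
          edgeProb γ (y i * y j) (dist (x i) (x j) ^ d))

lemma meas_A (k : ℕ) (w₀ s : ℝ) : MeasurableSet {y : Fin k → ℝ | ∀ i, w₀ ≤ s * y i} := by
  have : {y : Fin k → ℝ | ∀ i, w₀ ≤ s * y i} = ⋂ j, {y | w₀ ≤ s * y j} := by
    ext; simp
  rw [this]
  exact MeasurableSet.iInter fun j =>
    measurableSet_le measurable_const (by fun_prop)

lemma scaled (k d : ℕ) (τ γ w₀ M s ℓ : ℝ) (hs : 0 < s) (hM : s ^ 2 = M) (hw₀ : 0 < w₀)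
    (hℓ : 0 < ℓ) :
    ∫⁻ w : Fin k → ℝ in {w | ∀ i, w₀ ≤ w i},
      ∫⁻ x : Fin k → Fin d → AddCircle (1 : ℝ),
        ENNReal.ofReal ((∏ i, ℓ * w i ^ (-τ)) *
          ∏ i : Fin k, ∏ j ∈ Finset.Ioi i,
            edgeProb γ (w i * w j) (M * dist (x i) (x j) ^ d)) =
    ENNReal.ofReal (s ^ k * (ℓ * s ^ (-τ)) ^ k) *
      ∫⁻ y in {y : Fin k → ℝ | ∀ i, w₀ ≤ s * y i}, innerJ k d τ γ y := by
  have hm1 : MeasurableSet {w : Fin k → ℝ | ∀ i, w₀ ≤ w i} := by simpa using meas_A k w₀ 1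
  rw [← lintegral_indicator hm1, lint_smul k s hs, ← lintegral_indicator (meas_A k w₀ s),
    ENNReal.ofReal_mul (by positivity), mul_assoc]
  congr 1
  rw [← lintegral_const_mul' _ _ ENNReal.ofReal_ne_top]
  refine lintegral_congr fun y => ?_
  by_cases hy : ∀ i, w₀ ≤ s * y i
  · rw [Set.indicator_of_mem (by simpa using hy), Set.indicator_of_mem (by simpa using hy),
      innerJ, ← lintegral_const_mul' _ _ ENNReal.ofReal_ne_top]
    refine lintegral_congr fun x => ?_
    have hy0 : ∀ i, 0 < y i := fun i => pos_of_mul_pos_right (hw₀.trans_le (hy i)) hs.le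
    rw [← ENNReal.ofReal_mul (by positivity), ← mul_assoc]
    congr 2
    · have : (ℓ * s ^ (-τ)) ^ k = ∏ i : Fin k, (ℓ * s ^ (-τ)) := by simp
      rw [this, ← Finset.prod_mul_distrib]
      refine Finset.prod_congr rfl fun i _ => ?_
      rw [Pi.smul_apply, smul_eq_mul, Real.mul_rpow hs.le (hy0 i).le, mul_assoc]
    · refine Finset.prod_congr rfl fun i _ => Finset.prod_congr rfl fun j _ => ?_
      rw [← ep_scale (t := y i * y j) (c := M) (by rw [← hM]; positivity)]
      congr 1
      simp only [Pi.smul_apply, smul_eq_mul]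
      rw [← hM]; ring
  · rw [Set.indicator_of_notMem (by simpa using hy), Set.indicator_of_notMem (by simpa using hy),
      mul_zero]

lemma tendsto_A (k d : ℕ) (τ γ w₀ μ : ℝ) (hw₀ : 0 < w₀) (hμ : 0 < μ) :
    Filter.Tendsto (fun n : ℕ => ∫⁻ y in {y : Fin k → ℝ | ∀ i, w₀ ≤ √(μ * n) * y i},
      innerJ k d τ γ y) Filter.atTop (𝓝 (JNG k d τ γ)) := by
  have hU : ⋃ n : ℕ, {y : Fin k → ℝ | ∀ i, w₀ ≤ √(μ * n) * y i} = {y | ∀ i, 0 < y i} := by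
    ext y
    simp only [Set.mem_iUnion, Set.mem_ofPred_eq]
    constructor
    · rintro ⟨n, hn⟩ i
      exact pos_of_mul_pos_right (hw₀.trans_le (hn i)) (Real.sqrt_nonneg _)
    · intro hy
      have ht : Filter.Tendsto (fun n : ℕ => √(μ * n)) Filter.atTop Filter.atTop :=
        Real.tendsto_sqrt_atTop.comp
          (tendsto_natCast_atTop_atTop.const_mul_atTop hμ)
      have : ∀ i, ∀ᶠ n : ℕ in Filter.atTop, w₀ ≤ √(μ * n) * y i := fun i =>
        (ht.atTop_mul_const (hy i)).eventually_ge_atTop w₀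
      exact (Filter.eventually_all.2 this).exists
  have hmono : Monotone fun n : ℕ => {y : Fin k → ℝ | ∀ i, w₀ ≤ √(μ * n) * y i} := by
    intro n n' hnn y hy i
    have hyi : 0 < y i := pos_of_mul_pos_right (hw₀.trans_le (hy i)) (Real.sqrt_nonneg _)
    refine (hy i).trans (mul_le_mul_of_nonneg_right (Real.sqrt_le_sqrt ?_) hyi.le)
    have : (n:ℝ) ≤ n' := by exact_mod_cast hnn
    gcongr
  have := tendsto_measure_iUnion_atTop (μ := volume.withDensity (innerJ k d τ γ)) hmono
  rw [withDensity_apply _ (MeasurableSet.iUnion fun n => meas_A k w₀ _), hU] at this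
  refine this.congr fun n => ?_
  rw [Function.comp_apply, withDensity_apply _ (meas_A k w₀ _)]

/-- In the non-geometric regime `k > 2/(3-τ)`, `J^{NG}` is finite and the expected number
of `k`-cliques satisfies `E_n / n^{(3-τ)k/2} → ℓ^k · J^{NG} / (μ^{(τ-1)k/2}·k!)`. -/
theorem expected_cliques_nongeometric (k d : ℕ) (hk : 3 ≤ k) (hd : 1 ≤ d)
    (τ γ w₀ : ℝ) (hτ : 2 < τ) (hτ' : τ < 3) (hγ : 1 < γ) (hw₀ : 0 < w₀)
    (hkτ : (k : ℝ) > 2 / (3 - τ)) :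
    JNG k d τ γ ≠ ⊤ ∧
    Filter.Tendsto
      (fun n : ℕ => expectedCliques k d τ γ w₀ n / (n : ℝ) ^ ((3 - τ) * k / 2))
      Filter.atTop
      (𝓝 (paretoScale τ w₀ ^ k * (JNG k d τ γ).toReal /
        (paretoMean τ w₀ ^ ((τ - 1) * k / 2) * (Nat.factorial k : ℝ)))) := by
  have hJ : JNG k d τ γ ≠ ⊤ := by
    obtain ⟨K, rfl⟩ : ∃ K, k = K + 1 := ⟨k - 1, by omega⟩
    refine JNG_fin K d hd τ γ hτ hγ ?_
    have h3 : 0 < 3 - τ := by linarith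
    have := (div_lt_iff₀ h3).1 hkτ
    push_cast at this
    linarith
  refine ⟨hJ, ?_⟩
  set μ := paretoMean τ w₀ with hμdef
  set ℓ := paretoScale τ w₀ with hℓdef
  have hμ : 0 < μ := mul_pos (div_pos (by linarith) (by linarith)) hw₀
  have hℓ : 0 < ℓ := mul_pos (by linarith) (rpow_pos_of_pos hw₀ _)
  have hT := (ENNReal.tendsto_toReal hJ).comp (tendsto_A k d τ γ w₀ μ hw₀ hμ)
  have hc : Filter.Tendsto (fun n : ℕ => (n.choose k : ℝ) / (n:ℝ) ^ k) Filter.atTop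
      (𝓝 (1 / (Nat.factorial k : ℝ))) := by
    have h1 : Filter.Tendsto (fun n : ℕ => (n:ℝ) * (1 / (n:ℝ))) Filter.atTop (𝓝 1) := by
      refine tendsto_const_nhds.congr' ?_
      filter_upwards [Filter.eventually_gt_atTop 0] with n hn
      have : (n:ℝ) ≠ 0 := by positivity
      field_simp
    have := ProbabilityTheory.tendsto_choose_mul_pow_atTop k h1
    rw [one_pow] at this
    refine this.congr fun n => ?_
    rw [div_pow, one_pow, mul_one_div]
  have hfin := (hc.mul hT).const_mul (ℓ ^ k / μ ^ ((τ - 1) * k / 2))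
  have hlim : paretoScale τ w₀ ^ k * (JNG k d τ γ).toReal /
        (μ ^ ((τ - 1) * k / 2) * (Nat.factorial k : ℝ)) =
      ℓ ^ k / μ ^ ((τ - 1) * k / 2) * (1 / (Nat.factorial k : ℝ) * (JNG k d τ γ).toReal) := by
    rw [← hℓdef]
    ring
  rw [← hℓdef] at hlim
  rw [hlim]
  refine hfin.congr' ?_
  filter_upwards [Filter.eventually_gt_atTop 0] with n hn
  have hn0 : (0:ℝ) < n := by exact_mod_cast hn
  have hμn : 0 < μ * n := mul_pos hμ hn0
  unfold expectedCliques
  rw [← hμdef, ← hℓdef, scaled k d τ γ w₀ (μ * n) (√(μ * n)) ℓ (Real.sqrt_pos.2 hμn)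
    (Real.sq_sqrt hμn.le) hw₀ hℓ, ENNReal.toReal_mul, ENNReal.toReal_ofReal (by positivity)]
  simp only [Function.comp_apply]
  generalize (∫⁻ y in {y : Fin k → ℝ | ∀ i, w₀ ≤ √(μ * n) * y i}, innerJ k d τ γ y).toReal = I
  have e1 : √(μ * n) ^ k * (ℓ * √(μ * n) ^ (-τ)) ^ k =
      ℓ ^ k * ((μ ^ ((τ - 1) * k / 2))⁻¹ * ((n:ℝ) ^ ((3 - τ) * k / 2) / (n:ℝ) ^ k)) := by
    rw [mul_pow, mul_left_comm]
    congr 1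
    rw [← Real.rpow_natCast, ← Real.rpow_mul_natCast (Real.sqrt_nonneg _),
      ← Real.rpow_add (Real.sqrt_pos.2 hμn), Real.sqrt_eq_rpow, ← Real.rpow_mul hμn.le,
      Real.mul_rpow hμ.le hn0.le, ← Real.rpow_neg hμ.le, ← Real.rpow_natCast,
      ← Real.rpow_sub hn0]
    congr 2 <;> ring
  rw [e1]
  have hA : (n:ℝ) ^ ((3 - τ) * k / 2) ≠ 0 := (rpow_pos_of_pos hn0 _).ne'
  generalize (n:ℝ) ^ ((3 - τ) * k / 2) = A at *
  field_simp
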